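/- Let G be a simple graph on a finite vertex type V, A a set of vertices, C the type of connected components of the induced subgraph G[A], and let H ⊆ C be an arbitrary subset of the components (the 'high' components; the remaining components are 'low'). Define a simple graph G''' on V ⊕ C by: (inl u) and (inl w) are adjacent iff u ∉ A, w ∉ A, u ≠ w, and either G.Adj u w or there exists a low component Q ∉ H such that u and w are each adjacent in G to some vertex of Q; (inl u) and (inr P) are adjacent iff P ∈ H, u ∉ A, and u is adjacent in G to some vertex of P; and no two vertices inr P, inr P' are adjacent. Then for all u ∉ A and v ∉ A: u and v are reachable in G if and only if inl u and inl v are reachable in G'''. (This is the connectivity-preservation content of the paper's Lemma: the graph G* obtained by deleting V_A, adding a meta-vertex for each high component of G_A, and adding a complete graph on the outside neighbors of each low component, preserves connectivity among the vertices of V_B ∪ V_C.) -/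

import Mathlib

open Sum

/-- Vertices in the same component of an induced subgraph are reachable in the ambient graph. -/
theorem SimpleGraph.Reachable.of_induce_connectedComponentMk_eq {V : Type*} {G : SimpleGraph V}
    {A : Set V} {a b : A}
    (h : (G.induce A).connectedComponentMk a = (G.induce A).connectedComponentMk b) :
    G.Reachable a b :=
  (SimpleGraph.ConnectedComponent.exact h).map (SimpleGraph.Embedding.induce A).toHom

/-- A map sending adjacent vertices to reachable ones preserves reachability. -/
theorem SimpleGraph.Reachable.map_of_adj {V W : Type*} {G : SimpleGraph V} {G' : SimpleGraph W}
    (f : V → W) (hf : ∀ x y, G.Adj x y → G'.Reachable (f x) (f y)) {x y : V}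
    (h : G.Reachable x y) : G'.Reachable (f x) (f y) := by
  obtain ⟨p⟩ := h
  induction p with
  | nil => exact .refl _
  | cons hadj _ ih => exact (hf _ _ hadj).trans ih

/-- The graph `G*` of the paper: delete the vertices of `A`, add a meta-vertex
for each high component (`P ∈ H`) of `G[A]` joined to the outside vertices
adjacent to it, and add a complete graph on the outside neighbors of each low
component (`Q ∉ H`).  This preserves reachability among the vertices outside
`A`. -/
theorem stmt_7 {V : Type*} [Fintype V] (G : SimpleGraph V) (A : Set V)
    (H : Set ((G.induce A).ConnectedComponent))
    (G''' : SimpleGraph (V ⊕ (G.induce A).ConnectedComponent))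
    (h1 : ∀ u w : V, G'''.Adj (inl u) (inl w) ↔
      (u ∉ A ∧ w ∉ A ∧ u ≠ w ∧
        (G.Adj u w ∨ ∃ Q : (G.induce A).ConnectedComponent, Q ∉ H ∧
          (∃ a : A, (G.induce A).connectedComponentMk a = Q ∧ G.Adj u ↑a) ∧
          (∃ b : A, (G.induce A).connectedComponentMk b = Q ∧ G.Adj w ↑b))))
    (h2 : ∀ (u : V) (P : (G.induce A).ConnectedComponent),
      G'''.Adj (inl u) (inr P) ↔
        (P ∈ H ∧ u ∉ A ∧
          ∃ a : A, (G.induce A).connectedComponentMk a = P ∧ G.Adj u ↑a))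
    (h3 : ∀ P P' : (G.induce A).ConnectedComponent, ¬ G'''.Adj (inr P) (inr P')) :
    ∀ u v : V, u ∉ A → v ∉ A →
      (G.Reachable u v ↔ G'''.Reachable (inl u) (inl v)) := by
  intro u v hu hv
  have through {x w : V} (hx : x ∉ A) (hw : w ∉ A) {a b : A} (hxa : G.Adj x a)
      (hwb : G.Adj w b)
      (hab : (G.induce A).connectedComponentMk a = (G.induce A).connectedComponentMk b) :
      G'''.Reachable (inl x) (inl w) := by
    by_cases hH : (G.induce A).connectedComponentMk b ∈ H
    · exact ((h2 _ _).2 ⟨hH, hx, a, hab, hxa⟩).reachable.trans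
        ((h2 _ _).2 ⟨hH, hw, b, rfl, hwb⟩).reachable.symm
    · by_cases hxw : x = w
      · rw [hxw]
      · exact ((h1 _ _).2 ⟨hx, hw, hxw, .inr ⟨_, hH, ⟨a, hab, hxa⟩, ⟨b, rfl, hwb⟩⟩⟩).reachable
  constructor
  · rintro ⟨p⟩
    -- from a vertex of `A`, the walk leaves its component through an outside neighbour
    have exits : ∀ x, G.Walk x v → (x ∉ A → G'''.Reachable (inl x) (inl v)) ∧
        ∀ hx : x ∈ A, ∃ w ∉ A, ∃ b : A, (G.induce A).connectedComponentMk ⟨x, hx⟩ =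
          (G.induce A).connectedComponentMk b ∧ G.Adj w b ∧
          G'''.Reachable (inl w) (inl v) := by
      intro x q
      induction q with
      | nil => exact ⟨fun _ => .refl _, fun hx => absurd hx hv⟩
      | @cons x y z hxy q ih =>
        obtain ⟨ihout, ihin⟩ := ih hv p
        refine ⟨fun hx => ?_, fun hx => ?_⟩ <;> by_cases hy : y ∈ A
        · obtain ⟨w, hw, b, hb, hwb, hwv⟩ := ihin hy
          exact (through hx hw (a := ⟨y, hy⟩) hxy hwb hb).trans hwv
        · exact ((h1 _ _).2 ⟨hx, hy, hxy.ne, .inl hxy⟩).reachable.trans (ihout hy)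
        · obtain ⟨w, hw, b, hb, hwb, hwv⟩ := ihin hy
          have hadj : (G.induce A).Adj ⟨x, hx⟩ ⟨y, hy⟩ := hxy
          exact ⟨w, hw, b, (SimpleGraph.ConnectedComponent.sound hadj.reachable).trans hb, hwb, hwv⟩
        · exact ⟨y, hy, ⟨x, hx⟩, rfl, hxy.symm, ihout hy⟩
    exact (exits u p).1 hu
  · refine fun h => h.map_of_adj (Sum.elim id fun P => (P.out : V)) ?_
    have nbr {x : V} {a : A} {P : (G.induce A).ConnectedComponent}
        (ha : (G.induce A).connectedComponentMk a = P) (hxa : G.Adj x a) :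
        G.Reachable x (P.out : V) :=
      hxa.reachable.trans (.of_induce_connectedComponentMk_eq (ha.trans P.out_eq.symm))
    rintro (x | P) (y | Q) hadj
    · obtain ⟨-, -, -, hxy | ⟨Q, -, ⟨a, ha, hxa⟩, b, hb, hyb⟩⟩ := (h1 _ _).1 hadj
      · exact hxy.reachable
      · exact (nbr ha hxa).trans (nbr hb hyb).symm
    · obtain ⟨-, -, a, ha, hxa⟩ := (h2 _ _).1 hadj
      exact nbr ha hxa
    · obtain ⟨-, -, a, ha, hya⟩ := (h2 _ _).1 hadj.symm
      exact (nbr ha hya).symm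
    · exact absurd hadj (h3 _ _)
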